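/- arXiv:1404.7599 — 2 statements merged into one kernel-verified Lean document; each statement's English description precedes it below -/
import Mathlib

section
/- Let (𝒳, 𝒵, 𝒴) be a complete hereditary cotorsion triple in 𝒜 and let M, N be objects of 𝒜. Let p : X_M → M be a special right 𝒳-approximation of M (an epimorphism with X_M ∈ 𝒳 and Ker(p) ∈ 𝒵) and let i : N → Y^N be a special left 𝒴-approximation of N (a monomorphism with Y^N ∈ 𝒴 and Coker(i) ∈ 𝒵). Then the quotient of the abelian group Hom(X_M, N) by the subgroup of morphisms factoring through a projective object is isomorphic, as abelian group, to the quotient of Hom(M, Y^N) by the subgroup of morphisms factoring through an injective object. (Both compute Hom_{Ho(𝒜)}(M, N).) -/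
open CategoryTheory Abelian Limits ZeroObject

universe v u

variable {A : Type u} [Category.{v} A] [Abelian A]
  [EnoughProjectives A] [EnoughInjectives A]

noncomputable instance : HasExt.{max u v} A :=
  have := HasDerivedCategory.standard A
  hasExt_of_hasDerivedCategory A

/-- Vanishing of the `n`-th Ext group. -/
def extZero (M N : A) (n : ℕ) : Prop := Subsingleton (Abelian.Ext M N n)

/-- `(X, Z)` is a cotorsion pair: `X` consists exactly of the objects `M` with
`Ext¹(M, Z') = 0` for all `Z' ∈ Z`, and `Z` consists exactly of the objects `M`
with `Ext¹(X', M) = 0` for all `X' ∈ X`. -/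
def IsCotorsionPair (X Z : Set A) : Prop :=
  (∀ M : A, M ∈ X ↔ ∀ Z' ∈ Z, extZero M Z' 1) ∧
  (∀ M : A, M ∈ Z ↔ ∀ X' ∈ X, extZero X' M 1)

/-- A cotorsion pair is hereditary if `Ext^i(X', Z') = 0` for all `X' ∈ X`,
`Z' ∈ Z` and all `i ≥ 1`. -/
def IsHereditaryCotorsionPair (X Z : Set A) : Prop :=
  IsCotorsionPair X Z ∧ ∀ X' ∈ X, ∀ Z' ∈ Z, ∀ i : ℕ, 1 ≤ i → extZero X' Z' i

/-- A cotorsion pair is complete if every object `M` admits short exact sequences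
`0 → Z' → X' → M → 0` and `0 → M → Z'' → X'' → 0` with `X', X'' ∈ X` and `Z', Z'' ∈ Z`. -/
def IsCompleteCotorsionPair (X Z : Set A) : Prop :=
  IsCotorsionPair X Z ∧
    ∀ M : A,
      (∃ (Z' X' : A) (f : Z' ⟶ X') (g : X' ⟶ M) (w : f ≫ g = 0),
        (ShortComplex.mk f g w).ShortExact ∧ X' ∈ X ∧ Z' ∈ Z) ∧
      (∃ (Z'' X'' : A) (f : M ⟶ Z'') (g : Z'' ⟶ X'') (w : f ≫ g = 0),
        (ShortComplex.mk f g w).ShortExact ∧ X'' ∈ X ∧ Z'' ∈ Z)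

/-- `(X, Z, Y)` is a cotorsion triple if `(X, Z)` and `(Z, Y)` are cotorsion pairs. -/
def IsCotorsionTriple (X Z Y : Set A) : Prop :=
  IsCotorsionPair X Z ∧ IsCotorsionPair Z Y

/-- A cotorsion triple is hereditary if both constituent cotorsion pairs are hereditary. -/
def IsHereditaryCotorsionTriple (X Z Y : Set A) : Prop :=
  IsHereditaryCotorsionPair X Z ∧ IsHereditaryCotorsionPair Z Y

/-- A cotorsion triple is complete and hereditary if both constituent cotorsion pairs
are complete and hereditary. -/
def IsCompleteHereditaryCotorsionTriple (X Z Y : Set A) : Prop :=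
  IsCompleteCotorsionPair X Z ∧ IsCompleteCotorsionPair Z Y ∧
    IsHereditaryCotorsionPair X Z ∧ IsHereditaryCotorsionPair Z Y

/-- The subgroup of `Hom(X, Y)` of morphisms factoring through a projective object
(this set is already closed under the group operations, so taking the generated
subgroup does not change it). -/
def factorsThroughProjective (X Y : A) : AddSubgroup (X ⟶ Y) :=
  AddSubgroup.closure {h : X ⟶ Y | ∃ (P : A) (u : X ⟶ P) (v : P ⟶ Y),
    Projective P ∧ u ≫ v = h}

/-- The subgroup of `Hom(X, Y)` of morphisms factoring through an injective object. -/
def factorsThroughInjective (X Y : A) : AddSubgroup (X ⟶ Y) :=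
  AddSubgroup.closure {h : X ⟶ Y | ∃ (I : A) (u : X ⟶ I) (v : I ⟶ Y),
    Injective I ∧ u ≫ v = h}

lemma mem_ftp {X Y : A} (h : X ⟶ Y) : h ∈ factorsThroughProjective X Y ↔
    ∃ (P : A) (u : X ⟶ P) (v : P ⟶ Y), Projective P ∧ u ≫ v = h := by
  constructor
  · intro hh
    induction hh using AddSubgroup.closure_induction with
    | mem x hx => exact hx
    | zero => exact ⟨0, 0, 0, inferInstance, by simp⟩
    | add x y _ _ hx hy =>
      obtain ⟨P, u, v, hP, rfl⟩ := hx
      obtain ⟨Q, u2, v2, hQ, rfl⟩ := hy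
      exact ⟨P ⊞ Q, biprod.lift u u2, biprod.desc v v2, inferInstance, by simp⟩
    | neg x _ hx =>
      obtain ⟨P, u, v, hP, rfl⟩ := hx
      exact ⟨P, -u, v, hP, by simp⟩
  · intro hh
    exact AddSubgroup.subset_closure hh

lemma mem_fti {X Y : A} (h : X ⟶ Y) : h ∈ factorsThroughInjective X Y ↔
    ∃ (P : A) (u : X ⟶ P) (v : P ⟶ Y), Injective P ∧ u ≫ v = h := by
  constructor
  · intro hh
    induction hh using AddSubgroup.closure_induction with
    | mem x hx => exact hx
    | zero => exact ⟨0, 0, 0, inferInstance, by simp⟩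
    | add x y _ _ hx hy =>
      obtain ⟨P, u, v, hP, rfl⟩ := hx
      obtain ⟨Q, u2, v2, hQ, rfl⟩ := hy
      exact ⟨P ⊞ Q, biprod.lift u u2, biprod.desc v v2, inferInstance, by simp⟩
    | neg x _ hx =>
      obtain ⟨P, u, v, hP, rfl⟩ := hx
      exact ⟨P, -u, v, hP, by simp⟩
  · intro hh
    exact AddSubgroup.subset_closure hh

lemma shortExact_ker {X Y : A} (g : X ⟶ Y) [Epi g] :
    (ShortComplex.mk (kernel.ι g) g (kernel.condition g)).ShortExact where
  exact := ShortComplex.exact_of_f_is_kernel _ (kernelIsKernel g)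

lemma shortExact_coker {X Y : A} (g : X ⟶ Y) [Mono g] :
    (ShortComplex.mk g (cokernel.π g) (cokernel.condition g)).ShortExact where
  exact := ShortComplex.exact_of_g_is_cokernel _ (cokernelIsCokernel g)

lemma lift_of_ext {X P Z : A} (g : P ⟶ Z) [Epi g] (hX : extZero X (kernel g) 1) (a : X ⟶ Z) :
    ∃ b : X ⟶ P, b ≫ g = a := by
  obtain ⟨x, hx⟩ := Ext.covariant_sequence_exact₃ X (shortExact_ker g) (Ext.mk₀ a) (zero_add 1)
    (@Subsingleton.elim _ hX _ _)
  obtain ⟨b, rfl⟩ := (Ext.mk₀_bijective _ _).2 x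
  refine ⟨b, (Ext.mk₀_bijective _ _).1 ?_⟩
  rw [← hx, Ext.mk₀_comp_mk₀]

lemma extend_of_ext {Z I Y : A} (g : Z ⟶ I) [Mono g] (hY : extZero (cokernel g) Y 1)
    (a : Z ⟶ Y) : ∃ b : I ⟶ Y, g ≫ b = a := by
  obtain ⟨x, hx⟩ := Ext.contravariant_sequence_exact₁ (shortExact_coker g) Y (Ext.mk₀ a)
    (add_zero 1) (@Subsingleton.elim _ hY _ _)
  obtain ⟨b, rfl⟩ := (Ext.mk₀_bijective _ _).2 x
  refine ⟨b, (Ext.mk₀_bijective _ _).1 ?_⟩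
  rw [← hx, Ext.mk₀_comp_mk₀]

lemma extZero_ker {P Z Y : A} (g : P ⟶ Z) [Epi g] (h1 : extZero P Y 1) (h2 : extZero Z Y 2) :
    extZero (kernel g) Y 1 := by
  refine subsingleton_of_forall_eq 0 fun a => ?_
  obtain ⟨x, hx⟩ := Ext.contravariant_sequence_exact₁ (shortExact_ker g) Y a
    (n₁ := 2) rfl (@Subsingleton.elim _ h2 _ _)
  rw [← hx, @Subsingleton.elim _ h1 x 0, Ext.comp_zero]

lemma extZero_coker {X Z I : A} (g : Z ⟶ I) [Mono g] (h1 : extZero X I 1) (h2 : extZero X Z 2) :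
    extZero X (cokernel g) 1 := by
  refine subsingleton_of_forall_eq 0 fun a => ?_
  obtain ⟨x, hx⟩ := Ext.covariant_sequence_exact₃ X (shortExact_coker g) a
    (n₁ := 2) rfl (@Subsingleton.elim _ h2 _ _)
  rw [← hx, @Subsingleton.elim _ h1 x 0, Ext.zero_comp]

lemma extZero_proj (P Y : A) [Projective P] : extZero P Y 1 :=
  subsingleton_of_forall_eq 0 fun a => Ext.eq_zero_of_projective a

lemma extZero_inj (X I : A) [Injective I] : extZero X I 1 :=
  subsingleton_of_forall_eq 0 fun a => Ext.eq_zero_of_injective a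

lemma proj_mem {Zs Ys : Set A}
    (h2 : IsHereditaryCotorsionPair Zs Ys)
    (P : A) [Projective P] : P ∈ Zs :=
  (h2.1.1 P).2 fun _ _ => extZero_proj _ _

lemma inj_mem {Xs Zs : Set A}
    (h1 : IsHereditaryCotorsionPair Xs Zs)
    (I : A) [Injective I] : I ∈ Zs :=
  (h1.1.2 I).2 fun _ _ => extZero_inj _ _

lemma ker_mem {Zs Ys : Set A}
    (h2 : IsHereditaryCotorsionPair Zs Ys)
    {P Z : A} (g : P ⟶ Z) [Epi g] (hP : P ∈ Zs) (hZ : Z ∈ Zs) : kernel g ∈ Zs :=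
  (h2.1.1 _).2 fun Y hY => extZero_ker g (h2.2 _ hP _ hY 1 le_rfl) (h2.2 _ hZ _ hY 2 (by simp))

lemma coker_mem {Xs Zs : Set A}
    (h1 : IsHereditaryCotorsionPair Xs Zs)
    {Z I : A} (g : Z ⟶ I) [Mono g] (hZ : Z ∈ Zs) (hI : I ∈ Zs) : cokernel g ∈ Zs :=
  (h1.1.2 _).2 fun X hX => extZero_coker g (h1.2 _ hX _ hI 1 le_rfl) (h1.2 _ hX _ hZ 2 (by simp))

lemma factor_proj {Xs Zs Ys : Set A}
    (h1 : IsHereditaryCotorsionPair Xs Zs)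
    (h2 : IsHereditaryCotorsionPair Zs Ys)
    {X Z : A} (hX : X ∈ Xs) (hZ : Z ∈ Zs) (a : X ⟶ Z) :
    ∃ b : X ⟶ Projective.over Z, b ≫ Projective.π Z = a :=
  lift_of_ext _ (h1.2 _ hX _ (ker_mem h2 _ (proj_mem h2 _) hZ) 1 le_rfl) a

lemma factor_inj {Xs Zs Ys : Set A}
    (h1 : IsHereditaryCotorsionPair Xs Zs)
    (h2 : IsHereditaryCotorsionPair Zs Ys)
    {Z Y : A} (hZ : Z ∈ Zs) (hY : Y ∈ Ys) (a : Z ⟶ Y) :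
    ∃ b : Injective.under Z ⟶ Y, Injective.ι Z ≫ b = a :=
  extend_of_ext _ (h2.2 _ (coker_mem h1 _ hZ (inj_mem h1 _)) _ hY 1 le_rfl) a

lemma ftp_of_factor {Xs Zs Ys : Set A}
    (h1 : IsHereditaryCotorsionPair Xs Zs)
    (h2 : IsHereditaryCotorsionPair Zs Ys)
    {X Z Y : A} (hX : X ∈ Xs) (hZ : Z ∈ Zs) (a : X ⟶ Z) (c : Z ⟶ Y) :
    a ≫ c ∈ factorsThroughProjective X Y := by
  obtain ⟨b, rfl⟩ := factor_proj h1 h2 hX hZ a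
  exact (mem_ftp _).2 ⟨_, b, Projective.π Z ≫ c, inferInstance, by simp⟩

lemma fti_of_factor {Xs Zs Ys : Set A}
    (h1 : IsHereditaryCotorsionPair Xs Zs)
    (h2 : IsHereditaryCotorsionPair Zs Ys)
    {X Z Y : A} (hZ : Z ∈ Zs) (hY : Y ∈ Ys) (a : X ⟶ Z) (c : Z ⟶ Y) :
    a ≫ c ∈ factorsThroughInjective X Y := by
  obtain ⟨b, rfl⟩ := factor_inj h1 h2 hZ hY c
  exact (mem_fti _).2 ⟨_, a ≫ Injective.ι Z, b, inferInstance, by simp⟩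

lemma ftp_eq_fti {Xs Zs Ys : Set A}
    (h1 : IsHereditaryCotorsionPair Xs Zs)
    (h2 : IsHereditaryCotorsionPair Zs Ys)
    {X Y : A} (hX : X ∈ Xs) (hY : Y ∈ Ys) :
    factorsThroughProjective X Y = factorsThroughInjective X Y := by
  ext f
  constructor
  · intro hf
    obtain ⟨P, u, v, hP, rfl⟩ := (mem_ftp _).1 hf
    exact fti_of_factor h1 h2 (proj_mem h2 P) hY u v
  · intro hf
    obtain ⟨P, u, v, hP, rfl⟩ := (mem_fti _).1 hf
    exact ftp_of_factor h1 h2 hX (inj_mem h1 P) u v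

lemma left_iso {Xs Zs Ys : Set A}
    (h1 : IsHereditaryCotorsionPair Xs Zs)
    (h2 : IsHereditaryCotorsionPair Zs Ys)
    {N X Y : A} (i : N ⟶ Y) [Mono i] (hX : X ∈ Xs) (hC : cokernel i ∈ Zs) :
    Nonempty (((X ⟶ N) ⧸ factorsThroughProjective X N) ≃+
      ((X ⟶ Y) ⧸ factorsThroughProjective X Y)) := by
  let φ : (X ⟶ N) →+ ((X ⟶ Y) ⧸ factorsThroughProjective X Y) :=
    (QuotientAddGroup.mk' _).comp (Preadditive.rightComp X i)
  have hφ (f : X ⟶ N) : φ f = QuotientAddGroup.mk (f ≫ i) := rfl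
  have hse := shortExact_coker i
  have hsurj : Function.Surjective φ := by
    intro y
    obtain ⟨g, rfl⟩ := QuotientAddGroup.mk_surjective y
    obtain ⟨b, hb⟩ := factor_proj h1 h2 hX hC (g ≫ cokernel.π i)
    let v := Projective.factorThru (Projective.π (cokernel i)) (cokernel.π i)
    have hv : v ≫ cokernel.π i = Projective.π (cokernel i) := Projective.factorThru_comp _ _
    let l := hse.exact.lift (g - b ≫ v) (by simp [hb, hv])
    have hl : l ≫ i = g - b ≫ v := hse.exact.lift_f _ _
    refine ⟨l, ?_⟩
    rw [hφ, QuotientAddGroup.eq, hl]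
    exact (mem_ftp _).2 ⟨_, b, v, inferInstance, by abel⟩
  have hker : φ.ker = factorsThroughProjective X N := by
    ext f
    rw [AddMonoidHom.mem_ker, hφ, QuotientAddGroup.eq_zero_iff]
    constructor
    · intro hf
      obtain ⟨P, u, v, hP, huv⟩ := (mem_ftp _).1 hf
      let v2 := Projective.factorThru (Projective.π (cokernel i)) (cokernel.π i)
      have hv2 : v2 ≫ cokernel.π i = Projective.π (cokernel i) := Projective.factorThru_comp _ _
      let w : P ⊞ Projective.over (cokernel i) ⟶ Y := biprod.desc v v2
      have hw : Epi (w ≫ cokernel.π i) :=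
        epi_of_epi_fac (f := biprod.inr) (h := Projective.π (cokernel i)) (by simp [w, hv2])
      have hE := ker_mem h2 (w ≫ cokernel.π i) (proj_mem h2 _) hC
      let a : X ⟶ kernel (w ≫ cokernel.π i) := kernel.lift _ (u ≫ biprod.inl) (by
        simp [w, reassoc_of% huv])
      let e : kernel (w ≫ cokernel.π i) ⟶ N := hse.exact.lift (kernel.ι _ ≫ w) (by
        simpa using kernel.condition (w ≫ cokernel.π i))
      have he : e ≫ i = kernel.ι _ ≫ w := hse.exact.lift_f _ _
      have : f = a ≫ e := by
        rw [← cancel_mono i, Category.assoc, he]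
        simp [a, w, huv]
      rw [this]
      exact ftp_of_factor h1 h2 hX hE a e
    · intro hf
      obtain ⟨P, u, v, hP, rfl⟩ := (mem_ftp _).1 hf
      exact (mem_ftp _).2 ⟨P, u, v ≫ i, hP, by simp⟩
  exact ⟨(QuotientAddGroup.quotientAddEquivOfEq hker.symm).trans
    (QuotientAddGroup.quotientKerEquivOfSurjective φ hsurj)⟩

lemma right_iso {Xs Zs Ys : Set A}
    (h1 : IsHereditaryCotorsionPair Xs Zs)
    (h2 : IsHereditaryCotorsionPair Zs Ys)
    {M X Y : A} (p : X ⟶ M) [Epi p] (hY : Y ∈ Ys) (hK : kernel p ∈ Zs) :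
    Nonempty (((M ⟶ Y) ⧸ factorsThroughInjective M Y) ≃+
      ((X ⟶ Y) ⧸ factorsThroughInjective X Y)) := by
  let φ : (M ⟶ Y) →+ ((X ⟶ Y) ⧸ factorsThroughInjective X Y) :=
    (QuotientAddGroup.mk' _).comp (Preadditive.leftComp Y p)
  have hφ (f : M ⟶ Y) : φ f = QuotientAddGroup.mk (p ≫ f) := rfl
  have hse := shortExact_ker p
  let v := Injective.factorThru (Injective.ι (kernel p)) (kernel.ι p)
  have hv : kernel.ι p ≫ v = Injective.ι (kernel p) := Injective.comp_factorThru _ _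
  have hsurj : Function.Surjective φ := by
    intro y
    obtain ⟨g, rfl⟩ := QuotientAddGroup.mk_surjective y
    obtain ⟨b, hb⟩ := factor_inj h1 h2 hK hY (kernel.ι p ≫ g)
    let l := hse.exact.desc (g - v ≫ b) (by simp [hb, reassoc_of% hv])
    have hl : p ≫ l = g - v ≫ b := hse.exact.g_desc _ _
    refine ⟨l, ?_⟩
    rw [hφ, QuotientAddGroup.eq, hl]
    exact (mem_fti _).2 ⟨_, v, b, inferInstance, by abel⟩
  have hker : φ.ker = factorsThroughInjective M Y := by
    ext f
    rw [AddMonoidHom.mem_ker, hφ, QuotientAddGroup.eq_zero_iff]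
    constructor
    · intro hf
      obtain ⟨I, u, t, hI, hut⟩ := (mem_fti _).1 hf
      let w : X ⟶ I ⊞ Injective.under (kernel p) := biprod.lift u v
      have hw : Mono (kernel.ι p ≫ w) :=
        by
        have : Mono ((kernel.ι p ≫ w) ≫ biprod.snd) := by
          have h0 : (kernel.ι p ≫ w) ≫ biprod.snd = Injective.ι (kernel p) := by simp [w, hv]
          rw [h0]; infer_instance
        exact mono_of_mono _ biprod.snd
      have hE := coker_mem h1 (kernel.ι p ≫ w) hK (inj_mem h1 _)
      let a : cokernel (kernel.ι p ≫ w) ⟶ Y := cokernel.desc _ (biprod.fst ≫ t) (by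
        simp [w, hut])
      let e : M ⟶ cokernel (kernel.ι p ≫ w) := hse.exact.desc (w ≫ cokernel.π _) (by
        exact (Category.assoc _ _ _).symm.trans (cokernel.condition (kernel.ι p ≫ w)))
      have he : p ≫ e = w ≫ cokernel.π _ := hse.exact.g_desc _ _
      have : f = e ≫ a := by
        rw [← cancel_epi p, ← Category.assoc, he]
        simp [a, w, hut]
      rw [this]
      exact fti_of_factor h1 h2 hE hY e a
    · intro hf
      obtain ⟨P, u, v, hP, rfl⟩ := (mem_fti _).1 hf
      exact (mem_fti _).2 ⟨P, p ≫ u, v, hP, by simp⟩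
  exact ⟨(QuotientAddGroup.quotientAddEquivOfEq hker.symm).trans
    (QuotientAddGroup.quotientKerEquivOfSurjective φ hsurj)⟩

/-- Let `(𝒳, 𝒵, 𝒴)` be a complete hereditary cotorsion triple, let
`p : X_M ⟶ M` be a special right `𝒳`-approximation of `M` and `i : N ⟶ Y^N` a
special left `𝒴`-approximation of `N`. Then `Hom(X_M, N)` modulo morphisms
factoring through a projective object is isomorphic, as an abelian group, to
`Hom(M, Y^N)` modulo morphisms factoring through an injective object. -/
theorem stableHom_iso (Xs Zs Ys : Set A)
    (h : IsCompleteHereditaryCotorsionTriple Xs Zs Ys)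
    {M N XM YN : A}
    (p : XM ⟶ M) (hp : Epi p) (hXM : XM ∈ Xs) (hkerp : kernel p ∈ Zs)
    (i : N ⟶ YN) (hi : Mono i) (hYN : YN ∈ Ys) (hcoki : cokernel i ∈ Zs) :
    Nonempty (((XM ⟶ N) ⧸ factorsThroughProjective XM N) ≃+
      ((M ⟶ YN) ⧸ factorsThroughInjective M YN)) := by
  obtain ⟨-, -, h1, h2⟩ := h
  obtain ⟨e1⟩ := left_iso h1 h2 i hXM hcoki
  obtain ⟨e2⟩ := right_iso h1 h2 p hYN hkerp
  exact ⟨e1.trans ((QuotientAddGroup.quotientAddEquivOfEq (ftp_eq_fti h1 h2 hXM hYN)).trans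
    e2.symm)⟩
end

section
/- Let (𝒳, 𝒵, 𝒴) be a complete hereditary cotorsion triple in 𝒜 and let M ∈ 𝒵. Suppose ⋯ → X₂ → X₁ → X₀ → M → 0 is an exact sequence in 𝒜 with every X_j ∈ 𝒳 and with every syzygy in 𝒵 (i.e., Ker(X₀ → M) ∈ 𝒵 and Ker(X_j → X_{j-1}) ∈ 𝒵 for all j ≥ 1). Then every X_j is a projective object; consequently this sequence is a projective resolution of M, and for every object N and every i ≥ 0 the i-th cohomology of the complex Hom(X•, N) is naturally isomorphic to Ext^i(M, N). -/
open CategoryTheory Abelian Limits ZeroObject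

universe v u

variable {A : Type u} [Category.{v} A] [Abelian A]
  [EnoughProjectives A] [EnoughInjectives A]

section helpers

lemma ext_mid_zero {W : A} {S : ShortComplex A} (hS : S.ShortExact) (n : ℕ)
    (h1 : extZero W S.X₁ n) (h3 : extZero W S.X₃ n) : extZero W S.X₂ n := by
  refine subsingleton_of_forall_eq 0 fun x => ?_
  obtain ⟨y, hy⟩ := Ext.covariant_sequence_exact₂ W hS x
    (@Subsingleton.elim _ h3 _ _)
  have : y = 0 := @Subsingleton.elim _ h1 _ _
  rw [← hy, this, Ext.zero_comp]

lemma mem_Z_ext {Xs Zs : Set A} (h : IsCotorsionPair Xs Zs) {S : ShortComplex A}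
    (hS : S.ShortExact) (h1 : S.X₁ ∈ Zs) (h3 : S.X₃ ∈ Zs) : S.X₂ ∈ Zs := by
  rw [h.2]
  intro X' hX'
  exact ext_mid_zero hS 1 ((h.2 _).1 h1 _ hX') ((h.2 _).1 h3 _ hX')

lemma proj_of_mem {Xs Zs Ys : Set A}
    (h : IsCompleteHereditaryCotorsionTriple Xs Zs Ys) {P : A} (hX : P ∈ Xs) (hZ : P ∈ Zs) :
    Projective P := by
  obtain ⟨-, -, h1, h2⟩ := h
  let S := ShortComplex.mk (kernel.ι (Projective.π P)) (Projective.π P) (by simp)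
  have hS : S.ShortExact :=
    { exact := ShortComplex.exact_of_f_is_kernel _ (kernelIsKernel _)
      mono_f := by dsimp [S]; infer_instance
      epi_g := by dsimp [S]; infer_instance }
  have : Projective S.X₂ := by dsimp [S]; infer_instance
  have hK : S.X₁ ∈ Zs := by
    rw [h2.1.1]
    intro Y hY
    refine subsingleton_of_forall_eq 0 fun x => ?_
    obtain ⟨y, hy⟩ := Ext.contravariant_sequence_exact₁ hS Y x (n₁ := 2) rfl
      (@Subsingleton.elim _ (h2.2 P hZ Y hY 2 (by omega)) _ _)
    rw [← hy, Ext.eq_zero_of_projective y, Ext.comp_zero]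
  have hz : Subsingleton (Ext P S.X₁ 1) := h1.2 P hX _ hK 1 le_rfl
  obtain ⟨s, hs⟩ := Ext.covariant_sequence_exact₃ P hS (Ext.mk₀ (𝟙 P)) (n₁ := 1) rfl
    (@Subsingleton.elim _ hz _ _)
  obtain ⟨s, rfl⟩ := (Ext.mk₀_bijective _ _).2 s
  rw [Ext.mk₀_comp_mk₀] at hs
  have hs' := (Ext.mk₀_bijective _ _).1 hs
  exact (Retract.mk s S.g hs').projective

end helpers

section general

variable {C : Type u} [Category.{v} C] [Abelian C]

lemma exists_resolution {M : C} (K : ChainComplex C ℕ) (hp : ∀ n, Projective (K.X n))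
    (ε : K.X 0 ⟶ M) (hε : Epi ε) (w0 : K.d 1 0 ≫ ε = 0)
    (hex0 : (ShortComplex.mk _ _ w0).Exact)
    (hex : ∀ j, K.ExactAt (j + 1)) :
    ∃ R : ProjectiveResolution M, R.complex = K := by
  refine ⟨{ complex := K
            π := (ChainComplex.toSingle₀Equiv _ _).symm ⟨ε, w0⟩
            quasiIso := ⟨fun n => ?_⟩ }, rfl⟩
  cases n with
  | zero =>
    rw [ChainComplex.quasiIsoAt₀_iff, ShortComplex.quasiIso_iff_of_zeros']
    · refine (ShortComplex.exact_and_epi_g_iff_of_iso ?_).2 ⟨hex0, hε⟩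
      exact ShortComplex.isoMk (Iso.refl _) (Iso.refl _) (Iso.refl _)
        (by simp; exact (Category.id_comp _).trans (Category.comp_id _).symm)
        (by simp; exact (Category.id_comp _).trans (Category.comp_id _).symm)
    · exact K.shape _ _ (by simp)
    all_goals rfl
  | succ n =>
    rw [quasiIsoAt_iff_exactAt']
    · exact hex n
    · exact ChainComplex.exactAt_succ_single_obj _ _

universe w₁ w₂
lemma homology_equiv (S : ShortComplex AddCommGrpCat.{w₁}) {E : Type w₂} [AddCommGroup E]
    (φ : AddMonoidHom.ker S.g.hom →+ E) (hφ : Function.Surjective φ)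
    (hk : ∀ x, φ x = 0 ↔ ∃ y, S.f y = x.1) : Nonempty (S.homology ≃+ E) := by
  have hker : φ.ker = AddMonoidHom.range S.abToCycles := by
    ext x
    rw [AddMonoidHom.mem_ker, hk, AddMonoidHom.mem_range]
    constructor
    · rintro ⟨y, hy⟩; exact ⟨y, Subtype.ext hy⟩
    · rintro ⟨y, hy⟩; exact ⟨y, congrArg Subtype.val hy⟩
  exact ⟨(S.abHomologyIso.addCommGroupIsoToAddEquiv).trans
    ((QuotientAddGroup.quotientAddEquivOfEq hker.symm).trans
      (QuotientAddGroup.quotientKerEquivOfSurjective φ hφ))⟩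

open CategoryTheory.ProjectiveResolution CochainComplex HomComplex in
lemma extMk_zero_iff [HasExt.{w₁} C] {X Y : C} (R : ProjectiveResolution X)
    (f : R.complex.X 0 ⟶ Y) (hf : R.complex.d 1 0 ≫ f = 0) :
    R.extMk f 1 rfl hf = 0 ↔ f = 0 := by
  simp only [← R.extEquivCohomologyClass.apply_eq_iff_eq,
    extEquivCohomologyClass_extMk, extEquivCohomologyClass_zero,
    CohomologyClass.mk_eq_zero_iff]
  rw [Cocycle.toSingleMk_mem_coboundaries_iff _ _ _ _ _ 1 (by simp)]
  have hz : IsZero (R.cochainComplex.X 1) :=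
    CochainComplex.isZero_of_isStrictlyLE _ 0 _
  constructor
  · rintro ⟨g, hg⟩
    rw [hz.eq_of_src g 0, comp_zero] at hg
    rw [← cancel_epi (R.cochainComplexXIso (-(0:ℕ)) 0 rfl).hom, ← hg, comp_zero]
  · rintro rfl
    exact ⟨0, by simp⟩

lemma homology_resolution [HasExt.{w₁} C] {M : C} (R : ProjectiveResolution M) (N : C) (i : ℕ) :
    Nonempty
          (((((preadditiveYoneda.obj N).mapHomologicalComplex
                ((ComplexShape.down ℕ).symm)).obj
              (HomologicalComplex.op R.complex)).homology i) ≃+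
            Abelian.Ext M N i) := by
  let L := ((preadditiveYoneda.obj N).mapHomologicalComplex
                ((ComplexShape.down ℕ).symm)).obj (HomologicalComplex.op R.complex)
  have hd : ∀ a b (f : R.complex.X a ⟶ N), L.d a b f = R.complex.d b a ≫ f := fun _ _ _ => rfl
  have key : ∀ a, (∀ (f : R.complex.X i ⟶ N) hf, R.extMk f (i + 1) rfl hf = 0 ↔
      ∃ g : R.complex.X a ⟶ N, R.complex.d i a ≫ g = f) →
      Nonempty ((L.sc' a i (i + 1)).homology ≃+ Abelian.Ext M N i) := by
    intro a ha
    refine homology_equiv _ (AddMonoidHom.mk' (fun x => R.extMk (Y := N) x.1 (i + 1) rfl x.2) ?_) ?_ ?_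
    · intro x y
      exact (R.add_extMk _ _ _ _ _ _).symm
    · intro e
      obtain ⟨f, hf, rfl⟩ := R.extMk_surjective e (i + 1) rfl
      exact ⟨⟨f, hf⟩, rfl⟩
    · intro x
      exact ha x.1 x.2
  have hn : ((ComplexShape.down ℕ).symm).next i = i + 1 :=
    ComplexShape.next_eq' _ (by simp)
  cases i with
  | zero =>
    obtain ⟨e⟩ := key 0 (fun f hf => by
      rw [extMk_zero_iff]
      have : R.complex.d 0 0 = 0 := R.complex.shape _ _ (by simp)
      simp only [this, zero_comp, eq_comm, exists_const])
    have hp : ((ComplexShape.down ℕ).symm).prev 0 = 0 :=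
      ComplexShape.prev_eq_self' _ _ (by simp)
    exact ⟨((L.homologyIsoSc' _ _ _ hp hn).addCommGroupIsoToAddEquiv).trans e⟩
  | succ p =>
    obtain ⟨e⟩ := key p (fun f hf => R.extMk_eq_zero_iff f _ _ hf p rfl)
    have hp : ((ComplexShape.down ℕ).symm).prev (p + 1) = p :=
      ComplexShape.prev_eq' _ (by simp)
    exact ⟨((L.homologyIsoSc' _ _ _ hp hn).addCommGroupIsoToAddEquiv).trans e⟩

end general

/-- Let `(𝒳, 𝒵, 𝒴)` be a complete hereditary cotorsion triple, `M ∈ 𝒵`, and let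
`⋯ → X₁ → X₀ → M → 0` be an exact sequence with every `X_j ∈ 𝒳` and every syzygy
in `𝒵`. Then every `X_j` is projective; consequently, for every object `N` and
every `i ≥ 0`, the `i`-th cohomology of the complex `Hom(X•, N)` is isomorphic to
`Ext^i(M, N)`. -/
theorem resolution_projective (Xs Zs Ys : Set A)
    (h : IsCompleteHereditaryCotorsionTriple Xs Zs Ys)
    (M : A) (hM : M ∈ Zs)
    (X : ℕ → A) (d : ∀ j, X (j + 1) ⟶ X j) (ε : X 0 ⟶ M)
    (hε : Epi ε) (w0 : d 0 ≫ ε = 0) (w : ∀ j, d (j + 1) ≫ d j = 0)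
    (hex0 : (ShortComplex.mk (d 0) ε w0).Exact)
    (hex : ∀ j, (ShortComplex.mk (d (j + 1)) (d j) (w j)).Exact)
    (hX : ∀ j, X j ∈ Xs)
    (hsyz0 : kernel ε ∈ Zs) (hsyz : ∀ j, kernel (d j) ∈ Zs) :
    (∀ j, Projective (X j)) ∧
      ∀ (N : A) (i : ℕ),
        Nonempty
          (((((preadditiveYoneda.obj N).mapHomologicalComplex
                ((ComplexShape.down ℕ).symm)).obj
              (HomologicalComplex.op (ChainComplex.of X d w))).homology i) ≃+
            Abelian.Ext M N i) := by
  have hc : IsCotorsionPair Xs Zs := h.1.1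
  have ses : ∀ {P Q : A} (f : P ⟶ Q), Epi f → kernel f ∈ Zs → Q ∈ Zs → P ∈ Zs := by
    intro P Q f hf hk hQ
    refine mem_Z_ext hc (S := ShortComplex.mk (kernel.ι f) f (by simp)) ?_ hk hQ
    exact
      { exact := ShortComplex.exact_of_f_is_kernel _ (kernelIsKernel _)
        mono_f := by dsimp; infer_instance
        epi_g := hf }
  have ses' : ∀ {P Q R : A} (f : P ⟶ Q) (g : Q ⟶ R) (wfg : f ≫ g = 0),
      (ShortComplex.mk f g wfg).Exact → kernel f ∈ Zs → kernel g ∈ Zs → P ∈ Zs := by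
    intro P Q R f g wfg hfg hf hg
    have he : Epi (kernel.lift g f wfg) := hfg.epi_kernelLift
    refine mem_Z_ext hc (S := ShortComplex.mk (kernel.ι f) (kernel.lift g f wfg)
      (by rw [← cancel_mono (kernel.ι g)]; simp)) ?_ hf hg
    have hm : Mono (kernel.ι f) := inferInstance
    refine { exact := ?_, mono_f := hm, epi_g := he }
    refine ShortComplex.exact_of_f_is_kernel _ ?_
    refine KernelFork.IsLimit.ofι' _ _ fun {W} k hk => ⟨kernel.lift f k ?_, kernel.lift_ι _ _ _⟩
    have := congrArg (· ≫ kernel.ι g) hk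
    simpa using this
  have hXZ : ∀ j, X j ∈ Zs := by
    rintro (_ | _ | j)
    · exact ses ε hε hsyz0 hM
    · exact ses' _ _ w0 hex0 (hsyz 0) hsyz0
    · exact ses' _ _ (w j) (hex j) (hsyz _) (hsyz _)
  have hP : ∀ j, Projective (X j) := fun j => proj_of_mem h (hX j) (hXZ j)
  refine ⟨hP, fun N i => ?_⟩
  have hd : ∀ j, (ChainComplex.of X d w).d (j + 1) j = d j := fun j => ChainComplex.of_d ..
  obtain ⟨R, hR⟩ := exists_resolution (M := M) (ChainComplex.of X d w) hP ε hε
    (by rw [hd]; exact w0) (by convert hex0 using 2; exact hd 0) (fun j => by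
      rw [HomologicalComplex.exactAt_iff' _ (j + 1 + 1) (j + 1) j (by simp) (by simp)]
      refine (ShortComplex.exact_iff_of_iso ?_).2 (hex j)
      exact ShortComplex.isoMk (Iso.refl _) (Iso.refl _) (Iso.refl _)
        ((Category.id_comp _).trans ((hd _).symm.trans (Category.comp_id _).symm))
        ((Category.id_comp _).trans ((hd _).symm.trans (Category.comp_id _).symm)))
  rw [← hR]
  exact homology_resolution R N i
end
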